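/- arXiv:1109.5657 — 5 statements merged into one kernel-verified Lean document; each statement's English description precedes it below -/
import Mathlib

section
/- (Lemma 2.1, part 1.) For each fixed k>0, the function s↦α(k,s) is a well-defined real number for every s>0 (the infimum is finite), is continuous and locally Lipschitz on (0,∞), and is strictly increasing in s. -/
open MeasureTheory Set

/-- Piecewise-constant coefficient on `(-b,1)`: value `vm` below the interface `{0}`,
value `vp` above. -/
noncomputable def pw (vm vp : ℝ) (x : ℝ) : ℝ := if x < 0 then vm else vp

/-- First derivative within `[-b,1]`. -/
noncomputable def d1 (b : ℝ) (ψ : ℝ → ℝ) : ℝ → ℝ := derivWithin ψ (Set.Icc (-b) 1)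

/-- Second derivative within `[-b,1]`. -/
noncomputable def d2 (b : ℝ) (ψ : ℝ → ℝ) : ℝ → ℝ := derivWithin (d1 b ψ) (Set.Icc (-b) 1)

/-- The viscous part `E1(ψ;k)` of the energy. -/
noncomputable def E1 (b μm μp k : ℝ) (ψ : ℝ → ℝ) : ℝ :=
  (1 / 2) * ∫ x in (-b)..1,
    pw μm μp x * (4 * k ^ 2 * d1 b ψ x ^ 2 + (k ^ 2 * ψ x + d2 b ψ x) ^ 2)

/-- The boundary part `E0(ψ;k)` of the energy. -/
noncomputable def E0 (b g ρm ρp σm σp k : ℝ) (ψ : ℝ → ℝ) : ℝ :=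
  k ^ 2 / 2 * (σp * k ^ 2 + g * ρp) * ψ 1 ^ 2
    + k ^ 2 / 2 * (σm * k ^ 2 - g * (ρp - ρm)) * ψ 0 ^ 2

/-- The total energy `E(ψ;k,s) = s E1(ψ;k) + E0(ψ;k)`. -/
noncomputable def En (b g ρm ρp μm μp σm σp k s : ℝ) (ψ : ℝ → ℝ) : ℝ :=
  s * E1 b μm μp k ψ + E0 b g ρm ρp σm σp k ψ

/-- The normalization functional `J(ψ;k)`. -/
noncomputable def Jen (b ρm ρp k : ℝ) (ψ : ℝ → ℝ) : ℝ :=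
  (1 / 2) * ∫ x in (-b)..1, pw ρm ρp x * (k ^ 2 * ψ x ^ 2 + d1 b ψ x ^ 2)

/-- The admissible class `𝒜`: `ψ : ℝ → ℝ` twice continuously differentiable on `[-b,1]`
with `ψ(-b) = ψ'(-b) = 0`. -/
def memA (b : ℝ) (ψ : ℝ → ℝ) : Prop :=
  ContDiffOn ℝ 2 ψ (Set.Icc (-b) 1) ∧ ψ (-b) = 0 ∧ d1 b ψ (-b) = 0

/-- The set of energy values over the constraint class `𝒞(k) = {ψ ∈ 𝒜 : J(ψ;k) = 1}`. -/
noncomputable def enSet (b g ρm ρp μm μp σm σp k s : ℝ) : Set ℝ :=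
  En b g ρm ρp μm μp σm σp k s '' {ψ : ℝ → ℝ | memA b ψ ∧ Jen b ρm ρp k ψ = 1}

/-- `α(k,s) := inf {E(ψ;k,s) : ψ ∈ 𝒞(k)}`. -/
noncomputable def alpha (b g ρm ρp μm μp σm σp k s : ℝ) : ℝ :=
  sInf (enSet b g ρm ρp μm μp σm σp k s)

lemma aux_pw_int (vm vp a c : ℝ) : IntervalIntegrable (pw vm vp) volume a c := by
  rcases le_total vm vp with h | h
  · refine Monotone.intervalIntegrable (fun x y hxy => ?_)
    unfold pw
    split_ifs <;> linarith
  · refine Antitone.intervalIntegrable (fun x y hxy => ?_)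
    unfold pw
    split_ifs <;> linarith

lemma aux_cauchy {f : ℝ → ℝ} {a c : ℝ} (hac : a ≤ c) (hf : ContinuousOn f (Icc a c)) :
    (∫ x in a..c, f x) ^ 2 ≤ (c - a) * ∫ x in a..c, f x ^ 2 := by
  rcases hac.eq_or_lt with rfl | hlt
  · simp
  have hf' : ContinuousOn f (uIcc a c) := by rwa [uIcc_of_le hac]
  have i1 : IntervalIntegrable f volume a c := hf'.intervalIntegrable
  have i2 : IntervalIntegrable (fun x => f x ^ 2) volume a c := (hf'.pow 2).intervalIntegrable
  set I := ∫ x in a..c, f x with hI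
  set L := c - a with hL
  have hLpos : 0 < L := by linarith
  have h0 : 0 ≤ ∫ x in a..c, (L * f x - I) ^ 2 :=
    intervalIntegral.integral_nonneg hac (fun x _ => sq_nonneg _)
  have h1 : ∫ x in a..c, (L * f x - I) ^ 2
      = L ^ 2 * (∫ x in a..c, f x ^ 2) - 2 * L * I * I + L * I ^ 2 := by
    have : (fun x => (L * f x - I) ^ 2)
        = fun x => (L ^ 2 * f x ^ 2 - 2 * L * I * f x) + I ^ 2 := by
      funext x; ring
    rw [this, intervalIntegral.integral_add ((i2.const_mul _).sub (i1.const_mul _))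
      intervalIntegrable_const, intervalIntegral.integral_sub (i2.const_mul _) (i1.const_mul _),
      intervalIntegral.integral_const_mul, intervalIntegral.integral_const_mul,
      intervalIntegral.integral_const, ← hI, ← hL, smul_eq_mul]
  rw [h1] at h0
  have h2 : 0 ≤ L * (L * (∫ x in a..c, f x ^ 2) - I ^ 2) := by linarith
  have := nonneg_of_mul_nonneg_right h2 hLpos
  linarith

lemma aux_cont {b : ℝ} (hb : 0 < b) {ψ : ℝ → ℝ} (h : memA b ψ) :
    ContinuousOn ψ (Icc (-b) 1) ∧ ContinuousOn (d1 b ψ) (Icc (-b) 1) ∧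
      ContinuousOn (d2 b ψ) (Icc (-b) 1) := by
  have hu : UniqueDiffOn ℝ (Icc (-b) 1) := uniqueDiffOn_Icc (by linarith)
  have h1 : ContDiffOn ℝ 1 (d1 b ψ) (Icc (-b) 1) := h.1.derivWithin hu (by norm_num)
  exact ⟨h.1.continuousOn, h1.continuousOn, h1.continuousOn_derivWithin hu le_rfl⟩

/-- The Dirichlet energy. -/
noncomputable def auxQ (b : ℝ) (ψ : ℝ → ℝ) : ℝ := ∫ x in (-b)..1, d1 b ψ x ^ 2

lemma aux_point {b : ℝ} (hb : 0 < b) {ψ : ℝ → ℝ} (h : memA b ψ) {x : ℝ}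
    (hx : x ∈ Icc (-b) 1) : ψ x ^ 2 ≤ (1 + b) * auxQ b ψ := by
  obtain ⟨c0, c1, -⟩ := aux_cont hb h
  have hsub : Icc (-b) x ⊆ Icc (-b) 1 := Icc_subset_Icc le_rfl hx.2
  have hFTC : ∫ y in (-b)..x, d1 b ψ y = ψ x := by
    rw [intervalIntegral.integral_eq_sub_of_hasDerivAt_of_le hx.1 (c0.mono hsub), h.2.1, sub_zero]
    · intro y hy
      have hy' : y ∈ Icc (-b) 1 := hsub (Ioo_subset_Icc_self hy)
      exact ((h.1.differentiableOn (by norm_num)) y hy').hasDerivWithinAt.hasDerivAt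
        (Icc_mem_nhds hy.1 (hy.2.trans_le hx.2))
    · apply ContinuousOn.intervalIntegrable
      rw [uIcc_of_le hx.1]
      exact c1.mono hsub
  have hcs := aux_cauchy hx.1 (c1.mono hsub)
  rw [hFTC] at hcs
  have hi : IntervalIntegrable (fun x => d1 b ψ x ^ 2) volume (-b) 1 := by
    apply ContinuousOn.intervalIntegrable
    rw [uIcc_of_le (by linarith)]
    exact c1.pow 2
  have hm : ∫ y in (-b)..x, d1 b ψ y ^ 2 ≤ auxQ b ψ :=
    intervalIntegral.integral_mono_interval le_rfl hx.1 hx.2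
      (Filter.Eventually.of_forall fun y => sq_nonneg _) hi
  have h0 : 0 ≤ ∫ y in (-b)..x, d1 b ψ y ^ 2 :=
    intervalIntegral.integral_nonneg hx.1 (fun y _ => sq_nonneg _)
  calc ψ x ^ 2 ≤ (x - -b) * ∫ y in (-b)..x, d1 b ψ y ^ 2 := hcs
    _ ≤ (1 + b) * auxQ b ψ := by
      apply mul_le_mul _ hm h0 (by linarith)
      linarith [hx.2]

lemma aux_J_lower {b ρm ρp k : ℝ} (hb : 0 < b) (hρm : 0 < ρm) (hρ : ρm < ρp)
    {ψ : ℝ → ℝ} (h : memA b ψ) : ρm / 2 * auxQ b ψ ≤ Jen b ρm ρp k ψ := by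
  obtain ⟨c0, c1, -⟩ := aux_cont hb h
  have hle : -b ≤ 1 := by linarith
  rw [← uIcc_of_le hle] at c0 c1
  have key : ∫ x in (-b)..1, ρm * d1 b ψ x ^ 2
      ≤ ∫ x in (-b)..1, pw ρm ρp x * (k ^ 2 * ψ x ^ 2 + d1 b ψ x ^ 2) := by
    apply intervalIntegral.integral_mono_on hle
    · exact (continuousOn_const.mul (c1.pow 2)).intervalIntegrable
    · exact (aux_pw_int _ _ _ _).mul_continuousOn
        ((continuousOn_const.mul (c0.pow 2)).add (c1.pow 2))
    · intro x _
      have : ρm ≤ pw ρm ρp x := by unfold pw; split_ifs <;> linarith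
      have h1 : 0 ≤ k ^ 2 * ψ x ^ 2 := by positivity
      apply mul_le_mul this (by linarith) (sq_nonneg _) (by linarith)
  rw [intervalIntegral.integral_const_mul] at key
  unfold Jen auxQ
  linarith

lemma aux_J_upper {b ρm ρp k : ℝ} (hb : 0 < b) (hρm : 0 < ρm) (hρ : ρm < ρp)
    {ψ : ℝ → ℝ} (h : memA b ψ) :
    Jen b ρm ρp k ψ ≤ ρp / 2 * (k ^ 2 * (1 + b) ^ 2 + 1) * auxQ b ψ := by
  obtain ⟨c0, c1, -⟩ := aux_cont hb h
  have hle : -b ≤ 1 := by linarith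
  rw [← uIcc_of_le hle] at c0 c1
  have key : ∫ x in (-b)..1, pw ρm ρp x * (k ^ 2 * ψ x ^ 2 + d1 b ψ x ^ 2)
      ≤ ∫ x in (-b)..1, (ρp * (k ^ 2 * ((1 + b) * auxQ b ψ)) + ρp * d1 b ψ x ^ 2) := by
    apply intervalIntegral.integral_mono_on hle
    · exact (aux_pw_int _ _ _ _).mul_continuousOn
        ((continuousOn_const.mul (c0.pow 2)).add (c1.pow 2))
    · exact (continuousOn_const.add (continuousOn_const.mul (c1.pow 2))).intervalIntegrable
    · intro x hx
      have h1 : pw ρm ρp x ≤ ρp := by unfold pw; split_ifs <;> linarith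
      have h2 : k ^ 2 * ψ x ^ 2 ≤ k ^ 2 * ((1 + b) * auxQ b ψ) :=
        mul_le_mul_of_nonneg_left (aux_point hb h hx) (sq_nonneg k)
      rw [← mul_add]
      apply mul_le_mul h1 (by linarith) (by positivity) (by linarith)
  have i2 : IntervalIntegrable (fun x => ρp * d1 b ψ x ^ 2) volume (-b) 1 :=
    (continuousOn_const.mul (c1.pow 2)).intervalIntegrable
  rw [intervalIntegral.integral_add intervalIntegrable_const i2,
    intervalIntegral.integral_const, smul_eq_mul, intervalIntegral.integral_const_mul] at key
  change _ ≤ (1 - -b) * (ρp * (k ^ 2 * ((1 + b) * auxQ b ψ))) + ρp * auxQ b ψ at key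
  unfold Jen
  linarith

lemma aux_E1_lower {b μm μp k : ℝ} (hb : 0 < b) (hμm : 0 < μm) (hμp : 0 < μp)
    {ψ : ℝ → ℝ} (h : memA b ψ) : 2 * min μm μp * k ^ 2 * auxQ b ψ ≤ E1 b μm μp k ψ := by
  obtain ⟨c0, c1, c2⟩ := aux_cont hb h
  have hle : -b ≤ 1 := by linarith
  rw [← uIcc_of_le hle] at c0 c1 c2
  have key : ∫ x in (-b)..1, (min μm μp * (4 * k ^ 2)) * d1 b ψ x ^ 2
      ≤ ∫ x in (-b)..1,
        pw μm μp x * (4 * k ^ 2 * d1 b ψ x ^ 2 + (k ^ 2 * ψ x + d2 b ψ x) ^ 2) := by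
    apply intervalIntegral.integral_mono_on hle
    · exact (continuousOn_const.mul (c1.pow 2)).intervalIntegrable
    · exact (aux_pw_int _ _ _ _).mul_continuousOn
        ((continuousOn_const.mul (c1.pow 2)).add (((continuousOn_const.mul c0).add c2).pow 2))
    · intro x _
      have h1 : min μm μp ≤ pw μm μp x := by unfold pw; split_ifs <;> simp
      have h0 : 0 < min μm μp := lt_min hμm hμp
      rw [mul_assoc]
      apply mul_le_mul h1 (by linarith [sq_nonneg (k ^ 2 * ψ x + d2 b ψ x)]) (by positivity)
        (by linarith)
  rw [intervalIntegral.integral_const_mul] at key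
  unfold E1 auxQ
  linarith

lemma aux_nonempty {b ρm ρp k : ℝ} (hb : 0 < b) (hρm : 0 < ρm) (hρ : ρm < ρp) :
    ∃ ψ, memA b ψ ∧ Jen b ρm ρp k ψ = 1 := by
  have hle : -b ≤ 1 := by linarith
  have hscale : ∀ (a : ℝ) (φ : ℝ → ℝ) (x : ℝ), d1 b (fun x => a * φ x) x = a * d1 b φ x := by
    intro a φ x
    exact derivWithin_const_mul_field a
  let φ : ℝ → ℝ := fun x => (x + b) ^ 2
  have hφ : memA b φ := by
    refine ⟨by fun_prop, by simp [φ], ?_⟩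
    have hd : HasDerivAt φ (2 * (-b + b) ^ 1 * 1) (-b) := by
      have h := ((hasDerivAt_id (-b)).add_const b).pow 2
      exact h.congr_deriv (by simp)
    unfold d1
    rw [hd.hasDerivWithinAt.derivWithin
      (uniqueDiffOn_Icc (by linarith) _ (left_mem_Icc.2 hle))]
    simp
  have hQ : 0 < auxQ b φ := by
    have := aux_point hb hφ (right_mem_Icc.2 hle)
    have h1 : 0 < φ 1 ^ 2 := by
      have : 0 < φ 1 := by simp only [φ]; positivity
      positivity
    by_contra hcon
    push Not at hcon
    nlinarith
  have hJ : 0 < Jen b ρm ρp k φ :=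
    lt_of_lt_of_le (by positivity) (aux_J_lower hb hρm hρ hφ)
  set j := Jen b ρm ρp k φ with hj
  refine ⟨fun x => (Real.sqrt j)⁻¹ * φ x, ⟨contDiffOn_const.mul hφ.1, ?_, ?_⟩, ?_⟩
  · simp [hφ.2.1]
  · rw [hscale, hφ.2.2, mul_zero]
  · have hJs : ∀ a : ℝ, Jen b ρm ρp k (fun x => a * φ x) = a ^ 2 * Jen b ρm ρp k φ := by
      intro a
      unfold Jen
      rw [mul_left_comm (a ^ 2), ← intervalIntegral.integral_const_mul (a ^ 2)]
      congr 2
      funext x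
      rw [hscale]
      ring
    rw [hJs, ← hj, inv_pow, Real.sq_sqrt hJ.le, inv_mul_cancel₀ hJ.ne']

lemma aux_abstract {T : Type*} (S : Set T) (A B : T → ℝ) (c M : ℝ) (hc : 0 < c)
    (hS : S.Nonempty) (hA : ∀ t ∈ S, c ≤ A t) (hB : ∀ t ∈ S, -M ≤ B t) :
    (∀ s : ℝ, 0 < s → BddBelow ((fun t => s * A t + B t) '' S)) ∧
    ConcaveOn ℝ (Ioi 0) (fun s => sInf ((fun t => s * A t + B t) '' S)) ∧
    StrictMonoOn (fun s => sInf ((fun t => s * A t + B t) '' S)) (Ioi 0) := by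
  have hbd : ∀ s : ℝ, 0 < s → BddBelow ((fun t => s * A t + B t) '' S) := by
    intro s hs
    refine ⟨-M, ?_⟩
    rintro _ ⟨t, ht, rfl⟩
    have := mul_pos hs (hc.trans_le (hA t ht))
    have := hB t ht
    simp only
    linarith
  have hle : ∀ s : ℝ, 0 < s → ∀ t ∈ S,
      sInf ((fun t => s * A t + B t) '' S) ≤ s * A t + B t :=
    fun s hs t ht => csInf_le (hbd s hs) ⟨t, ht, rfl⟩
  refine ⟨hbd, ⟨convex_Ioi 0, ?_⟩, ?_⟩
  · intro x hx y hy p q hp hq hpq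
    apply le_csInf (hS.image _)
    rintro _ ⟨t, ht, rfl⟩
    have h1 := mul_le_mul_of_nonneg_left (hle x hx t ht) hp
    have h2 := mul_le_mul_of_nonneg_left (hle y hy t ht) hq
    simp only [smul_eq_mul]
    have h3 : (p * x + q * y) * A t + B t
        = p * (x * A t + B t) + q * (y * A t + B t) := by
      linear_combination -(B t) * hpq
    linarith
  · intro x hx y hy hxy
    have : sInf ((fun t => x * A t + B t) '' S) + (y - x) * c
        ≤ sInf ((fun t => y * A t + B t) '' S) := by
      apply le_csInf (hS.image _)
      rintro _ ⟨t, ht, rfl⟩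
      have h1 := hle x hx t ht
      have h2 := mul_le_mul_of_nonneg_left (hA t ht) (sub_pos.2 hxy).le
      simp only
      linarith
    have h3 : 0 < (y - x) * c := mul_pos (sub_pos.2 hxy) hc
    simp only
    linarith

/-- Lemma 2.1, part 1: for each fixed `k > 0`, `s ↦ α(k,s)` is a well-defined (finite)
infimum for every `s > 0`, is continuous and locally Lipschitz on `(0,∞)`, and is strictly
increasing in `s`. -/
theorem alpha_wellDefined_continuous_locallyLipschitz_strictMono
    (b g ρm ρp μm μp σm σp k : ℝ)
    (hb : 0 < b) (hg : 0 < g) (hρm : 0 < ρm) (hρ : ρm < ρp)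
    (hμm : 0 < μm) (hμp : 0 < μp) (hσm : 0 ≤ σm) (hσp : 0 ≤ σp) (hk : 0 < k) :
    (∀ s : ℝ, 0 < s →
      (enSet b g ρm ρp μm μp σm σp k s).Nonempty ∧
      BddBelow (enSet b g ρm ρp μm μp σm σp k s)) ∧
    ContinuousOn (fun s => alpha b g ρm ρp μm μp σm σp k s) (Set.Ioi 0) ∧
    (∀ s ∈ Set.Ioi (0 : ℝ), ∃ (K : NNReal) (t : Set ℝ), t ∈ nhdsWithin s (Set.Ioi 0) ∧
      LipschitzOnWith K (fun s => alpha b g ρm ρp μm μp σm σp k s) t) ∧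
    StrictMonoOn (fun s => alpha b g ρm ρp μm μp σm σp k s) (Set.Ioi 0) := by
  have hρp : 0 < ρp := hρm.trans hρ
  have hμ : 0 < min μm μp := lt_min hμm hμp
  obtain ⟨hbd, hconc, hmono⟩ := aux_abstract
    {ψ : ℝ → ℝ | memA b ψ ∧ Jen b ρm ρp k ψ = 1} (E1 b μm μp k) (E0 b g ρm ρp σm σp k)
    (2 * min μm μp * k ^ 2 * (1 / (ρp / 2 * (k ^ 2 * (1 + b) ^ 2 + 1))))
    (k ^ 2 / 2 * (g * (ρp - ρm)) * ((1 + b) * (2 / ρm)))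
    (by positivity) (aux_nonempty hb hρm hρ)
    (by
      rintro ψ ⟨hψ, hJ⟩
      have h1 := aux_J_upper (k := k) hb hρm hρ hψ
      rw [hJ] at h1
      have h2 : 1 / (ρp / 2 * (k ^ 2 * (1 + b) ^ 2 + 1)) ≤ auxQ b ψ := by
        rw [div_le_iff₀ (by positivity)]
        linarith
      exact (mul_le_mul_of_nonneg_left h2 (by positivity)).trans (aux_E1_lower hb hμm hμp hψ))
    (by
      rintro ψ ⟨hψ, hJ⟩
      have h1 := aux_J_lower (k := k) hb hρm hρ hψ
      rw [hJ] at h1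
      have h2 : auxQ b ψ ≤ 2 / ρm := by
        rw [le_div_iff₀ hρm]
        linarith
      have h3 : ψ 0 ^ 2 ≤ (1 + b) * (2 / ρm) :=
        (aux_point hb hψ ⟨by linarith, by norm_num⟩).trans
          (mul_le_mul_of_nonneg_left h2 (by linarith))
      have h4 : 0 < ρp - ρm := sub_pos.2 hρ
      have h5 := mul_le_mul_of_nonneg_left h3
        (show 0 ≤ k ^ 2 / 2 * (g * (ρp - ρm)) by positivity)
      have h6 : 0 ≤ k ^ 2 / 2 * (σp * k ^ 2 + g * ρp) * ψ 1 ^ 2 := by positivity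
      have h7 : 0 ≤ k ^ 2 / 2 * (σm * k ^ 2) * ψ 0 ^ 2 := by positivity
      unfold E0
      linarith)
  have hll := hconc.locallyLipschitzOn isOpen_Ioi
  refine ⟨fun s hs => ⟨Set.Nonempty.image _ (aux_nonempty hb hρm hρ), hbd s hs⟩,
    hll.continuousOn, ?_, hmono⟩
  intro s hs
  obtain ⟨K, t, ht, h⟩ := hll hs
  exact ⟨K, t, ht, h⟩
end

section
/- (Lemma 2.1, part 2, upper bound.) Assume 0<k<k_c, i.e. σ₋k²<g⟦ρ⟧. Then there exist constants C₀,C₁>0, depending only on ρ₊,ρ₋,μ₊,μ₋,σ₊,σ₋,b,g and k, such that α(k,s) ≤ −C₀ + sC₁ for all s>0. -/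
open MeasureTheory Set

/-- Scaling of the first derivative. -/
lemma d1_smul (b c : ℝ) (ψ : ℝ → ℝ) : d1 b (fun x => c * ψ x) = fun x => c * d1 b ψ x := by
  funext x
  simp only [d1]
  exact derivWithin_const_mul_field c

/-- The trace at the interface is controlled by `J`. -/
lemma trace_le (b ρm ρp k : ℝ) (hb : 0 < b) (hρm : 0 < ρm) (hρ : ρm < ρp) (hk : 0 < k)
    (ψ : ℝ → ℝ) (h : memA b ψ) : k * ρm / 2 * ψ 0 ^ 2 ≤ Jen b ρm ρp k ψ := by
  obtain ⟨hc, h0, -⟩ := h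
  have hlt : -b < 1 := by linarith
  have hψ : ContinuousOn ψ (Icc (-b) 1) := hc.continuousOn
  have hd : ContinuousOn (d1 b ψ) (Icc (-b) 1) :=
    hc.continuousOn_derivWithin (uniqueDiffOn_Icc hlt) (by norm_num)
  have hsub : Icc (-b) 0 ⊆ Icc (-b) 1 := Icc_subset_Icc le_rfl zero_le_one
  have hsub2 : Icc (0 : ℝ) 1 ⊆ Icc (-b) 1 := Icc_subset_Icc (by linarith) le_rfl
  have hmono : Monotone (pw ρm ρp) := by
    intro x y hxy
    unfold pw
    split_ifs <;> linarith
  have hpw : ∀ x, ρm ≤ pw ρm ρp x := by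
    intro x
    unfold pw
    split_ifs <;> linarith
  have hG : ContinuousOn (fun x => k ^ 2 * ψ x ^ 2 + d1 b ψ x ^ 2) (Icc (-b) 1) :=
    (continuousOn_const.mul (hψ.pow 2)).add (hd.pow 2)
  have hi1 : IntervalIntegrable (fun x => pw ρm ρp x * (k ^ 2 * ψ x ^ 2 + d1 b ψ x ^ 2))
      volume (-b) 0 := by
    refine hmono.intervalIntegrable.mul_continuousOn ?_
    rw [uIcc_of_le (by linarith)]
    exact hG.mono hsub
  have hi2 : IntervalIntegrable (fun x => pw ρm ρp x * (k ^ 2 * ψ x ^ 2 + d1 b ψ x ^ 2))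
      volume 0 1 := by
    refine hmono.intervalIntegrable.mul_continuousOn ?_
    rw [uIcc_of_le zero_le_one]
    exact hG.mono hsub2
  have hF : ContinuousOn (fun x => k * ρm * (2 * ψ x * d1 b ψ x)) (Icc (-b) 0) :=
    (continuousOn_const.mul ((continuousOn_const.mul hψ).mul hd)).mono hsub
  have hi3 : IntervalIntegrable (fun x => k * ρm * (2 * ψ x * d1 b ψ x)) volume (-b) 0 := by
    apply ContinuousOn.intervalIntegrable
    rw [uIcc_of_le (by linarith)]
    exact hF
  have hftc : ∫ x in (-b)..0, k * ρm * (2 * ψ x * d1 b ψ x)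
      = k * ρm * ψ 0 ^ 2 - k * ρm * ψ (-b) ^ 2 := by
    refine intervalIntegral.integral_eq_sub_of_hasDerivAt_of_le (f := fun x => k * ρm * ψ x ^ 2)
      (by linarith) ((continuousOn_const.mul (hψ.pow 2)).mono hsub) ?_ hi3
    intro x hx
    have hnhds : Icc (-b) 1 ∈ nhds x := Icc_mem_nhds hx.1 (by linarith [hx.2])
    have hdx : HasDerivAt ψ (d1 b ψ x) x :=
      ((hc.differentiableOn (by norm_num) x
        (hsub (Ioo_subset_Icc_self hx))).hasDerivWithinAt).hasDerivAt hnhds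
    have := (hdx.pow 2).const_mul (k * ρm)
    simpa using this
  have hle : ∫ x in (-b)..0, k * ρm * (2 * ψ x * d1 b ψ x)
      ≤ ∫ x in (-b)..0, pw ρm ρp x * (k ^ 2 * ψ x ^ 2 + d1 b ψ x ^ 2) := by
    refine intervalIntegral.integral_mono_on (by linarith) hi3 hi1 ?_
    intro x _
    have h1 : ρm * (k ^ 2 * ψ x ^ 2 + d1 b ψ x ^ 2)
        ≤ pw ρm ρp x * (k ^ 2 * ψ x ^ 2 + d1 b ψ x ^ 2) :=
      mul_le_mul_of_nonneg_right (hpw x) (by positivity)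
    have h2 : 0 ≤ ρm * (k * ψ x - d1 b ψ x) ^ 2 := by positivity
    nlinarith
  have hnn : 0 ≤ ∫ x in (0 : ℝ)..1, pw ρm ρp x * (k ^ 2 * ψ x ^ 2 + d1 b ψ x ^ 2) := by
    refine intervalIntegral.integral_nonneg zero_le_one ?_
    intro x _
    exact mul_nonneg (hρm.le.trans (hpw x)) (by positivity)
  have hadd := intervalIntegral.integral_add_adjacent_intervals hi1 hi2
  rw [h0] at hftc
  unfold Jen
  linarith

lemma E1_nonneg (b μm μp k : ℝ) (hb : 0 < b) (hμm : 0 < μm) (hμp : 0 < μp) (ψ : ℝ → ℝ) :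
    0 ≤ E1 b μm μp k ψ := by
  unfold E1
  refine mul_nonneg (by norm_num) (intervalIntegral.integral_nonneg (by linarith) ?_)
  intro x _
  refine mul_nonneg ?_ (by positivity)
  unfold pw
  split_ifs <;> linarith

lemma Jen_smul (b ρm ρp k c : ℝ) (ψ : ℝ → ℝ) :
    Jen b ρm ρp k (fun x => c * ψ x) = c ^ 2 * Jen b ρm ρp k ψ := by
  unfold Jen
  rw [d1_smul, mul_left_comm (c ^ 2), ← intervalIntegral.integral_const_mul (c ^ 2)]
  congr 2
  funext x
  ring

/-- The (unnormalized) test function. -/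
lemma memA_test (b c : ℝ) (hb : 0 < b) :
    memA b (fun x => c * ((x + b) ^ 2 * (x - 1) ^ 2)) := by
  refine ⟨ContDiff.contDiffOn (by fun_prop), by simp, ?_⟩
  have hd : HasDerivAt (fun x : ℝ => c * ((x + b) ^ 2 * (x - 1) ^ 2)) 0 (-b) := by
    have h1 := ((hasDerivAt_id (-b)).add_const b).pow 2
    have h2 := ((hasDerivAt_id (-b)).sub_const 1).pow 2
    have := (h1.mul h2).const_mul c
    simpa using this
  exact hd.hasDerivWithinAt.derivWithin
    (uniqueDiffOn_Icc (by linarith) _ (left_mem_Icc.2 (by linarith)))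

/-- Lemma 2.1, part 2, upper bound: in the subcritical regime `σ₋k² < g⟦ρ⟧` there are
constants `C₀, C₁ > 0` with `α(k,s) ≤ -C₀ + s C₁` for all `s > 0`. -/
theorem alpha_upper_bound
    (b g ρm ρp μm μp σm σp k : ℝ)
    (hb : 0 < b) (hg : 0 < g) (hρm : 0 < ρm) (hρ : ρm < ρp)
    (hμm : 0 < μm) (hμp : 0 < μp) (hσm : 0 ≤ σm) (hσp : 0 ≤ σp) (hk : 0 < k)
    (hsub : σm * k ^ 2 < g * (ρp - ρm)) :
    ∃ C₀ : ℝ, 0 < C₀ ∧ ∃ C₁ : ℝ, 0 < C₁ ∧ ∀ s : ℝ, 0 < s →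
      alpha b g ρm ρp μm μp σm σp k s ≤ -C₀ + s * C₁ := by
  have htest := memA_test b 1 hb
  have hJ : 0 < Jen b ρm ρp k (fun x => 1 * ((x + b) ^ 2 * (x - 1) ^ 2)) := by
    refine lt_of_lt_of_le ?_ (trace_le b ρm ρp k hb hρm hρ hk _ htest)
    have : (0 : ℝ) < 1 * ((0 + b) ^ 2 * (0 - 1) ^ 2) := by norm_num; positivity
    positivity
  simp only [one_mul] at hJ
  set J := Jen b ρm ρp k (fun x => (x + b) ^ 2 * (x - 1) ^ 2) with hJdef
  obtain ⟨c, hc, hcJ⟩ : ∃ c : ℝ, 0 < c ∧ c ^ 2 * J = 1 := by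
    refine ⟨(Real.sqrt J)⁻¹, by positivity, ?_⟩
    rw [inv_pow, Real.sq_sqrt hJ.le, inv_mul_cancel₀ hJ.ne']
  set φ : ℝ → ℝ := fun x => c * ((x + b) ^ 2 * (x - 1) ^ 2) with hφ
  have hφA : memA b φ := memA_test b c hb
  have hφJ : Jen b ρm ρp k φ = 1 := by
    rw [hφ, Jen_smul, ← hJdef, hcJ]
  have hφ0 : 0 < φ 0 := by
    have : φ 0 = c * b ^ 2 := by simp [hφ]
    rw [this]; positivity
  have hφ1 : φ 1 = 0 := by simp [hφ]
  have hE1 := E1_nonneg b μm μp k hb hμm hμp φ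
  refine ⟨k ^ 2 / 2 * (g * (ρp - ρm) - σm * k ^ 2) * φ 0 ^ 2, ?_, E1 b μm μp k φ + 1,
    by linarith, ?_⟩
  · have : 0 < g * (ρp - ρm) - σm * k ^ 2 := by linarith
    positivity
  intro s hs
  have hbdd : BddBelow (enSet b g ρm ρp μm μp σm σp k s) := by
    refine ⟨-(k ^ 2 / 2 * (g * (ρp - ρm) - σm * k ^ 2) * (2 / (k * ρm))), ?_⟩
    rintro _ ⟨ψ, ⟨hA, hJ1⟩, rfl⟩
    have ht := trace_le b ρm ρp k hb hρm hρ hk ψ hA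
    rw [hJ1] at ht
    have ht2 : ψ 0 ^ 2 ≤ 2 / (k * ρm) := by
      rw [le_div_iff₀ (by positivity)]
      linarith
    have hn := mul_nonneg hs.le (E1_nonneg b μm μp k hb hμm hμp ψ)
    have hρp : 0 < ρp := hρm.trans hρ
    have hp : 0 ≤ k ^ 2 / 2 * (σp * k ^ 2 + g * ρp) * ψ 1 ^ 2 := by positivity
    have hq : 0 ≤ k ^ 2 / 2 * (g * (ρp - ρm) - σm * k ^ 2) :=
      mul_nonneg (by positivity) (by linarith)
    have hm := mul_le_mul_of_nonneg_left ht2 hq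
    unfold En E0
    linarith
  refine (csInf_le hbdd ⟨φ, ⟨hφA, hφJ⟩, rfl⟩).trans ?_
  unfold En E0
  rw [hφ1]
  linarith
end

section
/- (Lemma 2.1, part 2, lower bound.) For each fixed k>0 there exists a constant C₂>0, depending only on ρ₊,ρ₋,μ₊,μ₋,σ₊,σ₋,b,g and k, such that α(k,s) ≥ −(2g⟦ρ⟧/ρ₋)k + sC₂ for all s>0. -/
open MeasureTheory Set

lemma pw_measurable (u v : ℝ) : Measurable (pw u v) := by
  unfold pw
  exact Measurable.ite measurableSet_Iio measurable_const measurable_const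

lemma pw_le (u v M : ℝ) (hu : u ≤ M) (hv : v ≤ M) (x : ℝ) : pw u v x ≤ M := by
  unfold pw; split_ifs <;> assumption

lemma le_pw (u v M : ℝ) (hu : M ≤ u) (hv : M ≤ v) (x : ℝ) : M ≤ pw u v x := by
  unfold pw; split_ifs <;> assumption

lemma pw_mul_integrable (u v b : ℝ) (hb : 0 < b) (f : ℝ → ℝ) (hf : ContinuousOn f (Icc (-b) 1)) :
    IntervalIntegrable (fun x => pw u v x * f x) volume (-b) 1 := by
  have hle : (-b) ≤ 1 := by linarith
  have h1 : IntervalIntegrable f volume (-b) 1 := hf.intervalIntegrable_of_Icc hle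
  rw [intervalIntegrable_iff] at h1 ⊢
  refine Integrable.bdd_mul (c := max |u| |v|) h1 (pw_measurable u v).aestronglyMeasurable ?_
  refine Filter.Eventually.of_forall fun x => ?_
  rw [Real.norm_eq_abs]
  unfold pw
  split_ifs
  · exact le_max_left _ _
  · exact le_max_right _ _

lemma cont_d1 (b : ℝ) (hb : 0 < b) (ψ : ℝ → ℝ) (h : ContDiffOn ℝ 2 ψ (Icc (-b) 1)) :
    ContinuousOn (d1 b ψ) (Icc (-b) 1) :=
  h.continuousOn_derivWithin (uniqueDiffOn_Icc (by linarith)) (by norm_num)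

lemma cont_d2 (b : ℝ) (hb : 0 < b) (ψ : ℝ → ℝ) (h : ContDiffOn ℝ 2 ψ (Icc (-b) 1)) :
    ContinuousOn (d2 b ψ) (Icc (-b) 1) := by
  have hu : UniqueDiffOn ℝ (Icc (-b) 1) := uniqueDiffOn_Icc (by linarith)
  have h1 : ContDiffOn ℝ 1 (d1 b ψ) (Icc (-b) 1) := h.derivWithin hu (by norm_num)
  exact h1.continuousOn_derivWithin hu (by norm_num)

lemma sq_bound (b : ℝ) (hb : 0 < b) (ψ : ℝ → ℝ) (h : memA b ψ) (ε : ℝ) (hε : 0 < ε)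
    (x : ℝ) (hx : x ∈ Icc (-b) 1) :
    ψ x ^ 2 ≤ ∫ t in (-b)..1, (ε * ψ t ^ 2 + ε⁻¹ * d1 b ψ t ^ 2) := by
  obtain ⟨hc, h0, -⟩ := h
  have hψ := hc.continuousOn
  have hd := cont_d1 b hb ψ hc
  have hsub : Icc (-b) x ⊆ Icc (-b) 1 := Icc_subset_Icc le_rfl hx.2
  have hsub2 : Icc x 1 ⊆ Icc (-b) 1 := Icc_subset_Icc hx.1 le_rfl
  have hcI : ContinuousOn (fun t => ε * ψ t ^ 2 + ε⁻¹ * d1 b ψ t ^ 2) (Icc (-b) 1) := by fun_prop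
  have hcP : ContinuousOn (fun t => 2 * ψ t * d1 b ψ t) (Icc (-b) 1) := by fun_prop
  have hi1 : IntervalIntegrable (fun t => 2 * ψ t * d1 b ψ t) volume (-b) x :=
    (hcP.mono hsub).intervalIntegrable_of_Icc hx.1
  have hi2 : IntervalIntegrable (fun t => ε * ψ t ^ 2 + ε⁻¹ * d1 b ψ t ^ 2) volume (-b) x :=
    (hcI.mono hsub).intervalIntegrable_of_Icc hx.1
  have hi3 : IntervalIntegrable (fun t => ε * ψ t ^ 2 + ε⁻¹ * d1 b ψ t ^ 2) volume x 1 :=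
    (hcI.mono hsub2).intervalIntegrable_of_Icc hx.2
  have ftc : ∫ t in (-b)..x, 2 * ψ t * d1 b ψ t = ψ x ^ 2 - ψ (-b) ^ 2 := by
    refine intervalIntegral.integral_eq_sub_of_hasDerivAt_of_le hx.1
      (f := fun t => ψ t ^ 2) ((hψ.mono hsub).pow 2) ?_ hi1
    intro t ht
    have htI : Icc (-b) 1 ∈ nhds t := Icc_mem_nhds ht.1 (lt_of_lt_of_le ht.2 hx.2)
    have hdt : HasDerivAt ψ (d1 b ψ t) t :=
      ((hc.differentiableOn (by norm_num) t
        (mem_of_mem_nhds htI)).hasDerivWithinAt).hasDerivAt htI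
    have := hdt.fun_pow 2
    simpa using this
  have hle1 : ∫ t in (-b)..x, 2 * ψ t * d1 b ψ t ≤
      ∫ t in (-b)..x, (ε * ψ t ^ 2 + ε⁻¹ * d1 b ψ t ^ 2) := by
    refine intervalIntegral.integral_mono_on hx.1 hi1 hi2 fun t _ => ?_
    have e : ε * ψ t ^ 2 + ε⁻¹ * d1 b ψ t ^ 2 - 2 * ψ t * d1 b ψ t
        = ε⁻¹ * (ε * ψ t - d1 b ψ t) ^ 2 := by
      field_simp; ring
    have : 0 ≤ ε⁻¹ * (ε * ψ t - d1 b ψ t) ^ 2 := by positivity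
    linarith
  have hpos : 0 ≤ ∫ t in x..1, (ε * ψ t ^ 2 + ε⁻¹ * d1 b ψ t ^ 2) :=
    intervalIntegral.integral_nonneg hx.2 fun t _ => by positivity
  have hadd := intervalIntegral.integral_add_adjacent_intervals hi2 hi3
  rw [h0] at ftc
  linarith

lemma sq_le_J (b ρm ρp k : ℝ) (hb : 0 < b) (hρm : 0 < ρm) (hρ : ρm < ρp) (hk : 0 < k)
    (ψ : ℝ → ℝ) (h : memA b ψ) (x : ℝ) (hx : x ∈ Icc (-b) 1) :
    ρm * k * ψ x ^ 2 ≤ 2 * Jen b ρm ρp k ψ := by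
  have h1 := sq_bound b hb ψ h k hk x hx
  have hψ := h.1.continuousOn
  have hd := cont_d1 b hb ψ h.1
  have hle : (-b) ≤ 1 := by linarith
  have hc1 : ContinuousOn (fun t => ρm * k * (k * ψ t ^ 2 + k⁻¹ * d1 b ψ t ^ 2)) (Icc (-b) 1) := by
    fun_prop
  have h2 : ∫ t in (-b)..1, ρm * k * (k * ψ t ^ 2 + k⁻¹ * d1 b ψ t ^ 2) ≤
      ∫ t in (-b)..1, pw ρm ρp t * (k ^ 2 * ψ t ^ 2 + d1 b ψ t ^ 2) := by
    refine intervalIntegral.integral_mono_on hle (hc1.intervalIntegrable_of_Icc hle)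
      (pw_mul_integrable ρm ρp b hb _ (by fun_prop)) fun t _ => ?_
    have e : ρm * k * (k * ψ t ^ 2 + k⁻¹ * d1 b ψ t ^ 2)
        = ρm * (k ^ 2 * ψ t ^ 2 + d1 b ψ t ^ 2) := by field_simp
    rw [e]
    exact mul_le_mul_of_nonneg_right (le_pw _ _ _ le_rfl hρ.le t) (by positivity)
  rw [intervalIntegral.integral_const_mul] at h2
  have h3 := mul_le_mul_of_nonneg_left h1 (by positivity : 0 ≤ ρm * k)
  unfold Jen
  linarith

lemma poincare (b : ℝ) (hb : 0 < b) (ψ : ℝ → ℝ) (h : memA b ψ) :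
    ∫ t in (-b)..1, ψ t ^ 2 ≤ 4 * (1 + b) ^ 2 * ∫ t in (-b)..1, d1 b ψ t ^ 2 := by
  have hψ := h.1.continuousOn
  have hd := cont_d1 b hb ψ h.1
  have hle : (-b) ≤ 1 := by linarith
  have hL : 0 < 1 + b := by linarith
  have i1 : IntervalIntegrable (fun t => ψ t ^ 2) volume (-b) 1 :=
    ContinuousOn.intervalIntegrable_of_Icc hle (by fun_prop)
  have i2 : IntervalIntegrable (fun t => d1 b ψ t ^ 2) volume (-b) 1 :=
    ContinuousOn.intervalIntegrable_of_Icc hle (by fun_prop)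
  have h1 := intervalIntegral.integral_mono_on hle i1
    (intervalIntegrable_const) (fun x hx => sq_bound b hb ψ h (2 * (1 + b))⁻¹ (by positivity) x hx)
  rw [intervalIntegral.integral_const, intervalIntegral.integral_add (i1.const_mul _)
    (i2.const_mul _), intervalIntegral.integral_const_mul, intervalIntegral.integral_const_mul,
    smul_eq_mul, inv_inv] at h1
  set A := ∫ t in (-b)..1, ψ t ^ 2
  set B := ∫ t in (-b)..1, d1 b ψ t ^ 2
  have e : (1 - -b) * ((2 * (1 + b))⁻¹ * A + 2 * (1 + b) * B) = A / 2 + 2 * (1 + b) ^ 2 * B := by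
    field_simp; ring
  rw [e] at h1
  linarith

lemma J_le (b ρm ρp k : ℝ) (hb : 0 < b) (hρm : 0 < ρm) (hρ : ρm < ρp)
    (ψ : ℝ → ℝ) (h : memA b ψ) :
    2 * Jen b ρm ρp k ψ ≤
      ρp * (4 * k ^ 2 * (1 + b) ^ 2 + 1) * ∫ t in (-b)..1, d1 b ψ t ^ 2 := by
  have hp := poincare b hb ψ h
  have hψ := h.1.continuousOn
  have hd := cont_d1 b hb ψ h.1
  have hle : (-b) ≤ 1 := by linarith
  have i1 : IntervalIntegrable (fun t => ψ t ^ 2) volume (-b) 1 :=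
    ContinuousOn.intervalIntegrable_of_Icc hle (by fun_prop)
  have i2 : IntervalIntegrable (fun t => d1 b ψ t ^ 2) volume (-b) 1 :=
    ContinuousOn.intervalIntegrable_of_Icc hle (by fun_prop)
  have h2 : ∫ t in (-b)..1, pw ρm ρp t * (k ^ 2 * ψ t ^ 2 + d1 b ψ t ^ 2) ≤
      ∫ t in (-b)..1, ρp * (k ^ 2 * ψ t ^ 2 + d1 b ψ t ^ 2) := by
    refine intervalIntegral.integral_mono_on hle (pw_mul_integrable ρm ρp b hb _ (by fun_prop))
      (((i1.const_mul _).add i2).const_mul _) fun t _ => ?_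
    exact mul_le_mul_of_nonneg_right (pw_le _ _ _ hρ.le le_rfl t) (by positivity)
  rw [intervalIntegral.integral_const_mul, intervalIntegral.integral_add (i1.const_mul _) i2,
    intervalIntegral.integral_const_mul] at h2
  have hρp : 0 < ρp := hρm.trans hρ
  have h3 := mul_le_mul_of_nonneg_left hp (by positivity : 0 ≤ ρp * k ^ 2)
  unfold Jen
  linarith

lemma le_E1 (b μm μp k : ℝ) (hb : 0 < b) (hμm : 0 < μm) (hμp : 0 < μp)
    (ψ : ℝ → ℝ) (h : memA b ψ) :
    2 * k ^ 2 * min μm μp * ∫ t in (-b)..1, d1 b ψ t ^ 2 ≤ E1 b μm μp k ψ := by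
  have hψ := h.1.continuousOn
  have hd := cont_d1 b hb ψ h.1
  have hd2 := cont_d2 b hb ψ h.1
  have hle : (-b) ≤ 1 := by linarith
  have hm : 0 < min μm μp := lt_min hμm hμp
  have i2 : IntervalIntegrable (fun t => d1 b ψ t ^ 2) volume (-b) 1 :=
    ContinuousOn.intervalIntegrable_of_Icc hle (by fun_prop)
  have h2 : ∫ t in (-b)..1, (4 * k ^ 2 * min μm μp) * d1 b ψ t ^ 2 ≤
      ∫ x in (-b)..1, pw μm μp x * (4 * k ^ 2 * d1 b ψ x ^ 2 + (k ^ 2 * ψ x + d2 b ψ x) ^ 2) := by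
    refine intervalIntegral.integral_mono_on hle (i2.const_mul _)
      (pw_mul_integrable μm μp b hb _ (by fun_prop)) fun t _ => ?_
    have h3 : min μm μp * (4 * k ^ 2 * d1 b ψ t ^ 2 + (k ^ 2 * ψ t + d2 b ψ t) ^ 2) ≤ 
      pw μm μp t * (4 * k ^ 2 * d1 b ψ t ^ 2 + (k ^ 2 * ψ t + d2 b ψ t) ^ 2) :=
      mul_le_mul_of_nonneg_right (le_pw _ _ _ (min_le_left _ _) (min_le_right _ _) t)
        (by positivity)
    have h4 : 0 ≤ min μm μp * (k ^ 2 * ψ t + d2 b ψ t) ^ 2 := by positivity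
    linarith
  rw [intervalIntegral.integral_const_mul] at h2
  unfold E1
  linarith

lemma exists_adm (b ρm ρp k : ℝ) (hb : 0 < b) (hρm : 0 < ρm) (hρ : ρm < ρp) (hk : 0 < k) :
    ∃ ψ : ℝ → ℝ, memA b ψ ∧ Jen b ρm ρp k ψ = 1 := by
  have hu : UniqueDiffOn ℝ (Icc (-b) 1) := uniqueDiffOn_Icc (by linarith)
  have hd : ∀ c : ℝ, ∀ x ∈ Icc (-b) 1, d1 b (fun x => c * (x + b) ^ 2) x = c * (2 * (x + b)) := by
    intro c x hx
    have : HasDerivAt (fun x : ℝ => c * (x + b) ^ 2) (c * (2 * (x + b))) x := by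
      have := (((hasDerivAt_id x).add_const b).fun_pow 2).const_mul c
      simpa using this
    exact this.hasDerivWithinAt.derivWithin (hu x hx)
  have hA : ∀ c : ℝ, memA b (fun x => c * (x + b) ^ 2) := by
    intro c
    refine ⟨by fun_prop, by simp, ?_⟩
    rw [hd c _ ⟨le_rfl, by linarith⟩]; simp
  have hJ : ∀ c : ℝ, Jen b ρm ρp k (fun x => c * (x + b) ^ 2)
      = c ^ 2 * Jen b ρm ρp k (fun x => 1 * (x + b) ^ 2) := by
    intro c
    unfold Jen
    rw [mul_left_comm, ← intervalIntegral.integral_const_mul (c ^ 2)]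
    congr 1
    apply intervalIntegral.integral_congr
    intro x hx
    rw [uIcc_of_le (by linarith)] at hx
    simp only [hd _ x hx]
    ring
  have hpos : 0 < Jen b ρm ρp k (fun x => 1 * (x + b) ^ 2) := by
    have := sq_le_J b ρm ρp k hb hρm hρ hk _ (hA 1) 1 ⟨by linarith, le_rfl⟩
    have h2 : 0 < ρm * k * (1 * (1 + b) ^ 2) ^ 2 := by positivity
    linarith
  refine ⟨_, hA (Real.sqrt (Jen b ρm ρp k (fun x => 1 * (x + b) ^ 2)))⁻¹, ?_⟩
  rw [hJ, inv_pow, Real.sq_sqrt hpos.le, inv_mul_cancel₀ (ne_of_gt hpos)]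

/-- Lemma 2.1, part 2, lower bound: for each fixed `k > 0` there is a constant `C₂ > 0`
with `α(k,s) ≥ -(2g⟦ρ⟧/ρ₋)k + s C₂` for all `s > 0`. -/
theorem alpha_lower_bound
    (b g ρm ρp μm μp σm σp k : ℝ)
    (hb : 0 < b) (hg : 0 < g) (hρm : 0 < ρm) (hρ : ρm < ρp)
    (hμm : 0 < μm) (hμp : 0 < μp) (hσm : 0 ≤ σm) (hσp : 0 ≤ σp) (hk : 0 < k) :
    ∃ C₂ : ℝ, 0 < C₂ ∧ ∀ s : ℝ, 0 < s →
      -(2 * g * (ρp - ρm) / ρm) * k + s * C₂ ≤ alpha b g ρm ρp μm μp σm σp k s := by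
  have hρp : 0 < ρp := hρm.trans hρ
  have hm : 0 < min μm μp := lt_min hμm hμp
  have hK : 0 < ρp * (4 * k ^ 2 * (1 + b) ^ 2 + 1) := by positivity
  refine ⟨2 * k ^ 2 * min μm μp * (2 / (ρp * (4 * k ^ 2 * (1 + b) ^ 2 + 1))), by positivity, ?_⟩
  intro s hs
  unfold alpha
  refine le_csInf ?_ ?_
  · obtain ⟨ψ, hψ⟩ := exists_adm b ρm ρp k hb hρm hρ hk
    exact ⟨_, ψ, hψ, rfl⟩
  rintro _ ⟨ψ, ⟨hA, hJ⟩, rfl⟩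
  have h1 := sq_le_J b ρm ρp k hb hρm hρ hk ψ hA 0 ⟨by linarith, by norm_num⟩
  have h2 := J_le b ρm ρp k hb hρm hρ ψ hA
  have h3 := le_E1 b μm μp k hb hμm hμp ψ hA
  rw [hJ] at h1 h2
  have h4 : 2 / (ρp * (4 * k ^ 2 * (1 + b) ^ 2 + 1)) ≤ ∫ t in (-b)..1, d1 b ψ t ^ 2 := by
    rw [div_le_iff₀ hK]; linarith
  have h5 := mul_le_mul_of_nonneg_left h4 (by positivity : 0 ≤ 2 * k ^ 2 * min μm μp)
  have h6 := mul_le_mul_of_nonneg_left (h5.trans h3) hs.le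
  have hj : 0 < ρp - ρm := by linarith
  have h7 : k ^ 2 / 2 * (g * (ρp - ρm)) * ψ 0 ^ 2 ≤ 2 * g * (ρp - ρm) / ρm * k := by
    have h8 := mul_le_mul_of_nonneg_left h1 (by positivity : 0 ≤ k / 2 * (g * (ρp - ρm)) / ρm)
    have e1 : k / 2 * (g * (ρp - ρm)) / ρm * (ρm * k * ψ 0 ^ 2)
        = k ^ 2 / 2 * (g * (ρp - ρm)) * ψ 0 ^ 2 := by field_simp
    have e2 : k / 2 * (g * (ρp - ρm)) / ρm * (2 * 1)
        = 2 * g * (ρp - ρm) / ρm * k - g * (ρp - ρm) / ρm * k := by ring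
    have e3 : 0 ≤ g * (ρp - ρm) / ρm * k := by positivity
    linarith
  have h9 : 0 ≤ k ^ 2 / 2 * (σp * k ^ 2 + g * ρp) * ψ 1 ^ 2 := by positivity
  have h10 : 0 ≤ k ^ 2 / 2 * (σm * k ^ 2) * ψ 0 ^ 2 := by positivity
  unfold En E0
  linarith
end

section
/- (Coercivity of the viscous energy, used in the proof of Lemma 2.1.) For each fixed k>0 the infimum of E1(·;k) over the constraint class is positive: there exists a constant C₂>0 such that E1(ψ;k) ≥ C₂ for every ψ∈𝒞(k). -/
open MeasureTheory Set

lemma pw_intervalIntegrable (b vm vp : ℝ) (f : ℝ → ℝ) (hb : 0 < b)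
    (hf : ContinuousOn f (Set.Icc (-b) 1)) :
    IntervalIntegrable (fun x => pw vm vp x * f x) volume (-b) 1 := by
  have h1 : IntervalIntegrable f volume (-b) 1 := by
    apply ContinuousOn.intervalIntegrable
    rwa [Set.uIcc_of_le (by linarith)]
  rw [intervalIntegrable_iff] at h1 ⊢
  have hm : Measurable (pw vm vp) := by
    unfold pw
    exact Measurable.ite measurableSet_Iio measurable_const measurable_const
  refine Integrable.bdd_mul (c := max |vm| |vp|) h1 hm.aestronglyMeasurable ?_
  refine Filter.Eventually.of_forall (fun x => ?_)
  unfold pw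
  split_ifs <;> simp

/-- Coercivity of the viscous energy: for each fixed `k > 0` there is `C₂ > 0` with
`E1(ψ;k) ≥ C₂` for every `ψ` in the constraint class `𝒞(k)`. -/
theorem E1_coercive_on_constraint
    (b g ρm ρp μm μp σm σp k : ℝ)
    (hb : 0 < b) (hg : 0 < g) (hρm : 0 < ρm) (hρ : ρm < ρp)
    (hμm : 0 < μm) (hμp : 0 < μp) (hσm : 0 ≤ σm) (hσp : 0 ≤ σp) (hk : 0 < k) :
    ∃ C₂ : ℝ, 0 < C₂ ∧ ∀ ψ : ℝ → ℝ, memA b ψ → Jen b ρm ρp k ψ = 1 →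
      C₂ ≤ E1 b μm μp k ψ := by
  have hL : 0 < 1 + b := by linarith
  obtain ⟨m, hm, hm1, hm2⟩ : ∃ m : ℝ, 0 < m ∧ m ≤ μm ∧ m ≤ μp :=
    ⟨min μm μp, lt_min hμm hμp, min_le_left _ _, min_le_right _ _⟩
  have hρp : 0 < ρp := hρm.trans hρ
  obtain ⟨K, hK, hKe⟩ : ∃ K : ℝ, 0 < K ∧ K * (4 * m * k ^ 2) = ρp * (1 + 4 * k ^ 2 * (1 + b) ^ 2) :=
    ⟨ρp * (1 + 4 * k ^ 2 * (1 + b) ^ 2) / (4 * m * k ^ 2), by positivity, by field_simp⟩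
  refine ⟨1 / K, by positivity, ?_⟩
  rintro ψ ⟨hψ, h0, -⟩ hJ
  have hlt : -b < 1 := by linarith
  have hU : UniqueDiffOn ℝ (Set.Icc (-b) 1) := uniqueDiffOn_Icc hlt
  have hd1 : ContDiffOn ℝ 1 (d1 b ψ) (Set.Icc (-b) 1) := hψ.derivWithin hU (by norm_num)
  have c0 := hψ.continuousOn
  have c1 := hd1.continuousOn
  have c2 : ContinuousOn (d2 b ψ) (Set.Icc (-b) 1) :=
    hd1.continuousOn_derivWithin hU (by norm_num)
  have iJ := pw_intervalIntegrable b ρm ρp (fun x => k ^ 2 * ψ x ^ 2 + d1 b ψ x ^ 2) hb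
    (by fun_prop)
  have iE := pw_intervalIntegrable b μm μp
    (fun x => 4 * k ^ 2 * d1 b ψ x ^ 2 + (k ^ 2 * ψ x + d2 b ψ x) ^ 2) hb (by fun_prop)
  have iF : IntervalIntegrable (fun x => ψ x ^ 2 + (x - 1) * (2 * ψ x * d1 b ψ x))
      volume (-b) 1 := by
    apply ContinuousOn.intervalIntegrable
    rw [Set.uIcc_of_le hlt.le]
    fun_prop
  have hF : ∫ x in (-b)..1, (ψ x ^ 2 + (x - 1) * (2 * ψ x * d1 b ψ x)) = 0 := by
    rw [intervalIntegral.integral_eq_sub_of_hasDerivAt_of_le hlt.le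
      (f := fun x => (x - 1) * ψ x ^ 2) (by fun_prop) ?_ iF]
    · simp [h0]
    · intro x hx
      have hd : HasDerivAt ψ (d1 b ψ x) x :=
        ((hψ.differentiableOn (by norm_num)) x ⟨hx.1.le, hx.2.le⟩).hasDerivWithinAt.hasDerivAt
          (Icc_mem_nhds hx.1 hx.2)
      have := ((hasDerivAt_id x).sub_const 1).mul (hd.pow 2)
      refine this.congr_deriv ?_
      simp
  have key := intervalIntegral.integral_mono_on hlt.le iJ
    ((iE.const_mul K).add (iF.const_mul (2 * ρp * k ^ 2))) ?_
  · rw [intervalIntegral.integral_add (iE.const_mul K) (iF.const_mul _),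
      intervalIntegral.integral_const_mul, intervalIntegral.integral_const_mul, hF] at key
    unfold Jen at hJ
    unfold E1
    rw [div_le_iff₀ hK]
    linarith
  · intro x hx
    have hr : pw ρm ρp x ≤ ρp := by unfold pw; split_ifs <;> linarith
    have hmu : m ≤ pw μm μp x := by unfold pw; split_ifs <;> linarith
    generalize ψ x = p, d1 b ψ x = q, d2 b ψ x = r, pw ρm ρp x = R, pw μm μp x = M at *
    have e1 : R * (k ^ 2 * p ^ 2 + q ^ 2) ≤ ρp * (k ^ 2 * p ^ 2 + q ^ 2) :=
      mul_le_mul_of_nonneg_right hr (by positivity)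
    have e2 : m * (4 * k ^ 2 * q ^ 2) ≤ M * (4 * k ^ 2 * q ^ 2 + (k ^ 2 * p + r) ^ 2) :=
      mul_le_mul hmu (by nlinarith [sq_nonneg (k ^ 2 * p + r)]) (by positivity) (by linarith)
    have e3 := mul_le_mul_of_nonneg_left e2 hK.le
    have e4 : K * (m * (4 * k ^ 2 * q ^ 2)) = ρp * (1 + 4 * k ^ 2 * (1 + b) ^ 2) * q ^ 2 := by
      rw [← hKe]; ring
    have e5 : (x - 1) ^ 2 ≤ (1 + b) ^ 2 := by
      have := hx.1; have := hx.2; nlinarith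
    have e6 : p ^ 2 / 2 - 2 * (1 + b) ^ 2 * q ^ 2 ≤ p ^ 2 + (x - 1) * (2 * p * q) := by
      nlinarith [sq_nonneg (p + 2 * (x - 1) * q), mul_le_mul_of_nonneg_right e5 (sq_nonneg q)]
    have e7 := mul_le_mul_of_nonneg_left e6 (by positivity : 0 ≤ 2 * ρp * k ^ 2)
    nlinarith
end

section
/- (Proposition 2.3, frequency bounds and limiting behavior.) For any k>0, every s>0 satisfying the fixed-point relation α(k,s)=−s² obeys s² ≤ (2g⟦ρ⟧/ρ₋)k; moreover necessarily σ₋k²<g⟦ρ⟧, and s² ≤ (2k/ρ₋)(g⟦ρ⟧−σ₋k²). In particular, the fixed-point growth rate λ(k) tends to 0 as k→0⁺, and when σ₋>0 it tends to 0 as k→√(g⟦ρ⟧/σ₋)⁻. -/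
open MeasureTheory Set

/-- Trace bound for `ψ(0)²` by the normalization functional. -/
lemma trace_bound (b ρm ρp k : ℝ) (hb : 0 < b) (hρm : 0 < ρm) (hρ : ρm < ρp) (hk : 0 < k)
    (ψ : ℝ → ℝ) (hψ : memA b ψ) : k * ρm * ψ 0 ^ 2 ≤ 2 * Jen b ρm ρp k ψ := by
  obtain ⟨hc, h0, -⟩ := hψ
  have hlt : -b < 1 := by linarith
  have hud : UniqueDiffOn ℝ (Icc (-b) 1) := uniqueDiffOn_Icc hlt
  have hψc : ContinuousOn ψ (Icc (-b) 1) := hc.continuousOn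
  have hdc : ContinuousOn (d1 b ψ) (Icc (-b) 1) :=
    hc.continuousOn_derivWithin hud (by norm_num)
  have hsub : Icc (-b) 0 ⊆ Icc (-b) 1 := Icc_subset_Icc_right zero_le_one
  have hder : ∀ x ∈ Ioo (-b) 0, HasDerivAt (fun y => ψ y ^ 2) (2 * ψ x * d1 b ψ x) x := by
    intro x hx
    have hxm : x ∈ Icc (-b) 1 := hsub (Ioo_subset_Icc_self hx)
    have h1 : HasDerivWithinAt ψ (d1 b ψ x) (Icc (-b) 1) x :=
      ((hc.differentiableOn (by norm_num)) x hxm).hasDerivWithinAt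
    have h2 : HasDerivAt ψ (d1 b ψ x) x :=
      h1.hasDerivAt (Icc_mem_nhds hx.1 (by linarith [hx.2]))
    have h3 : HasDerivAt (fun y => ψ y ^ 2) (((2 : ℕ) : ℝ) * ψ x ^ (2 - 1) * d1 b ψ x) x :=
      h2.pow 2
    have e : ((2 : ℕ) : ℝ) * ψ x ^ (2 - 1) * d1 b ψ x = 2 * ψ x * d1 b ψ x := by norm_num
    rwa [e] at h3
  have hI1 : IntervalIntegrable (fun x => 2 * ψ x * d1 b ψ x) volume (-b) 0 := by
    apply ContinuousOn.intervalIntegrable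
    rw [uIcc_of_le (by linarith)]
    exact ((continuousOn_const.mul hψc).mul hdc).mono hsub
  have hftc : ∫ x in (-b)..0, 2 * ψ x * d1 b ψ x = ψ 0 ^ 2 - ψ (-b) ^ 2 :=
    intervalIntegral.integral_eq_sub_of_hasDerivAt_of_le (by linarith)
      ((hψc.pow 2).mono hsub) hder hI1
  have hmono : Monotone (pw ρm ρp) := by
    intro x y hxy
    unfold pw
    split_ifs <;> linarith
  have hI2 : IntervalIntegrable (fun x => pw ρm ρp x * (k ^ 2 * ψ x ^ 2 + d1 b ψ x ^ 2))
      volume (-b) 1 := by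
    apply (hmono.intervalIntegrable).mul_continuousOn
    rw [uIcc_of_le hlt.le]
    exact (continuousOn_const.mul (hψc.pow 2)).add (hdc.pow 2)
  have hpos : ∀ x, ρm ≤ pw ρm ρp x := by
    intro x
    unfold pw
    split_ifs <;> linarith
  have hnn : ∀ x, 0 ≤ pw ρm ρp x * (k ^ 2 * ψ x ^ 2 + d1 b ψ x ^ 2) := fun x =>
    mul_nonneg (hρm.le.trans (hpos x)) (by positivity)
  have hle1 : ∫ x in (-b)..0, pw ρm ρp x * (k ^ 2 * ψ x ^ 2 + d1 b ψ x ^ 2) ≤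
      ∫ x in (-b)..1, pw ρm ρp x * (k ^ 2 * ψ x ^ 2 + d1 b ψ x ^ 2) :=
    intervalIntegral.integral_mono_interval le_rfl (by linarith) zero_le_one
      (Filter.Eventually.of_forall hnn) hI2
  have hle2 : ∫ x in (-b)..0, k * ρm * (2 * ψ x * d1 b ψ x) ≤
      ∫ x in (-b)..0, pw ρm ρp x * (k ^ 2 * ψ x ^ 2 + d1 b ψ x ^ 2) := by
    apply intervalIntegral.integral_mono_on (by linarith) (hI1.const_mul _)
    · apply hI2.mono_set
      rw [uIcc_of_le (by linarith), uIcc_of_le hlt.le]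
      exact hsub
    · intro x _
      have h1 : ρm * (k ^ 2 * ψ x ^ 2 + d1 b ψ x ^ 2) ≤
          pw ρm ρp x * (k ^ 2 * ψ x ^ 2 + d1 b ψ x ^ 2) :=
        mul_le_mul_of_nonneg_right (hpos x) (by positivity)
      have h2 : 0 ≤ ρm * (k * ψ x - d1 b ψ x) ^ 2 := by positivity
      nlinarith
  rw [intervalIntegral.integral_const_mul, hftc, h0] at hle2
  unfold Jen
  linarith

/-- The fixed-point bounds. -/
lemma fixed_point_bounds
    (b g ρm ρp μm μp σm σp : ℝ)
    (hb : 0 < b) (hg : 0 < g) (hρm : 0 < ρm) (hρ : ρm < ρp)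
    (hμm : 0 < μm) (hμp : 0 < μp) (hσm : 0 ≤ σm) (hσp : 0 ≤ σp)
    (k : ℝ) (hk : 0 < k) (s : ℝ) (hs : 0 < s)
    (ha : alpha b g ρm ρp μm μp σm σp k s = -(s ^ 2)) :
      s ^ 2 ≤ 2 * g * (ρp - ρm) / ρm * k ∧
      σm * k ^ 2 < g * (ρp - ρm) ∧
      s ^ 2 ≤ 2 * k / ρm * (g * (ρp - ρm) - σm * k ^ 2) := by
  set M : ℝ := max (g * (ρp - ρm) - σm * k ^ 2) 0 with hM
  have hM0 : 0 ≤ M := le_max_right _ _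
  have hM1 : g * (ρp - ρm) - σm * k ^ 2 ≤ M := le_max_left _ _
  have hlow : -(k / ρm * M) ≤ alpha b g ρm ρp μm μp σm σp k s := by
    apply Real.le_sInf
    · rintro _ ⟨ψ, ⟨hA, hJ⟩, rfl⟩
      have ht := trace_bound b ρm ρp k hb hρm hρ hk ψ hA
      rw [hJ] at ht
      have hE1 : 0 ≤ E1 b μm μp k ψ := by
        unfold E1
        apply mul_nonneg (by norm_num)
        apply intervalIntegral.integral_nonneg (by linarith)
        intro x _
        apply mul_nonneg _ (by positivity)
        unfold pw
        split_ifs <;> linarith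
      have hp : 0 ≤ k ^ 2 / 2 * (σp * k ^ 2 + g * ρp) * ψ 1 ^ 2 := by
        have : 0 < ρp := hρm.trans hρ
        positivity
      have h1 : k ^ 2 / 2 * (g * (ρp - ρm) - σm * k ^ 2) * ψ 0 ^ 2 ≤
          k ^ 2 / 2 * M * ψ 0 ^ 2 := by gcongr
      have h2 : k ^ 2 / 2 * M * ψ 0 ^ 2 ≤ k / ρm * M := by
        have h3 : k / (2 * ρm) * M * (k * ρm * ψ 0 ^ 2) ≤ k / (2 * ρm) * M * (2 * 1) := by
          gcongr
        have e1 : k / (2 * ρm) * M * (k * ρm * ψ 0 ^ 2) = k ^ 2 / 2 * M * ψ 0 ^ 2 := by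
          field_simp
        have e2 : k / (2 * ρm) * M * (2 * 1) = k / ρm * M := by
          field_simp
        rw [e1, e2] at h3
        exact h3
      have h4 : 0 ≤ s * E1 b μm μp k ψ := mul_nonneg hs.le hE1
      unfold En E0
      nlinarith
    · have : 0 ≤ k / ρm * M := by positivity
      linarith
  rw [ha] at hlow
  have hs2 : 0 < s ^ 2 := by positivity
  have hsub : σm * k ^ 2 < g * (ρp - ρm) := by
    by_contra! h
    have : M = 0 := max_eq_right (by linarith)
    rw [this] at hlow
    linarith
  have hMe : M = g * (ρp - ρm) - σm * k ^ 2 := max_eq_left (by linarith)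
  have h5 : s ^ 2 ≤ 2 * k / ρm * (g * (ρp - ρm) - σm * k ^ 2) := by
    rw [← hMe]
    have e : 2 * k / ρm * M = 2 * (k / ρm * M) := by ring
    have : 0 ≤ k / ρm * M := by positivity
    linarith
  refine ⟨h5.trans ?_, hsub, h5⟩
  have e : 2 * g * (ρp - ρm) / ρm * k = 2 * k / ρm * (g * (ρp - ρm)) := by ring
  rw [e]
  gcongr
  have : 0 ≤ σm * k ^ 2 := by positivity
  linarith

/-- Proposition 2.3, frequency bounds and limiting behavior of the fixed-point growth
rate: any fixed point `s > 0` of `α(k,·) = -s²` satisfies `s² ≤ (2g⟦ρ⟧/ρ₋)k`, forces the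
subcritical condition `σ₋k² < g⟦ρ⟧`, and satisfies `s² ≤ (2k/ρ₋)(g⟦ρ⟧ - σ₋k²)`.  In
particular any growth-rate function `λ(k)` (a choice of fixed point for each subcritical
`k`) tends to `0` as `k → 0⁺`, and, when `σ₋ > 0`, as `k → √(g⟦ρ⟧/σ₋)⁻`. -/
theorem growth_rate_frequency_bounds_and_limits
    (b g ρm ρp μm μp σm σp : ℝ)
    (hb : 0 < b) (hg : 0 < g) (hρm : 0 < ρm) (hρ : ρm < ρp)
    (hμm : 0 < μm) (hμp : 0 < μp) (hσm : 0 ≤ σm) (hσp : 0 ≤ σp) :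
    (∀ k : ℝ, 0 < k → ∀ s : ℝ, 0 < s →
      alpha b g ρm ρp μm μp σm σp k s = -(s ^ 2) →
      s ^ 2 ≤ 2 * g * (ρp - ρm) / ρm * k ∧
      σm * k ^ 2 < g * (ρp - ρm) ∧
      s ^ 2 ≤ 2 * k / ρm * (g * (ρp - ρm) - σm * k ^ 2)) ∧
    (∀ lam : ℝ → ℝ,
      (∀ k : ℝ, 0 < k → σm * k ^ 2 < g * (ρp - ρm) →
        0 < lam k ∧ alpha b g ρm ρp μm μp σm σp k (lam k) = -((lam k) ^ 2)) →
      Filter.Tendsto lam (nhdsWithin 0 (Set.Ioi 0)) (nhds 0) ∧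
      (0 < σm →
        Filter.Tendsto lam
          (nhdsWithin (Real.sqrt (g * (ρp - ρm) / σm))
            (Set.Iio (Real.sqrt (g * (ρp - ρm) / σm)))) (nhds 0))) := by
  refine ⟨fun k hk s hs ha =>
    fixed_point_bounds b g ρm ρp μm μp σm σp hb hg hρm hρ hμm hμp hσm hσp k hk s hs ha, ?_⟩
  intro lam hlam
  have hD : 0 < g * (ρp - ρm) := mul_pos hg (by linarith)
  have hbd : ∀ k : ℝ, 0 < k → σm * k ^ 2 < g * (ρp - ρm) →
      0 ≤ lam k ∧ lam k ≤ Real.sqrt (2 * k / ρm * (g * (ρp - ρm) - σm * k ^ 2)) := by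
    intro k hk hkc
    obtain ⟨hl, ha⟩ := hlam k hk hkc
    exact ⟨hl.le, Real.le_sqrt_of_sq_le (fixed_point_bounds b g ρm ρp μm μp σm σp hb hg hρm hρ
      hμm hμp hσm hσp k hk _ hl ha).2.2⟩
  have hcont : Continuous
      (fun k : ℝ => Real.sqrt (2 * k / ρm * (g * (ρp - ρm) - σm * k ^ 2))) := by
    fun_prop
  have key : ∀ (k₀ : ℝ) (S : Set ℝ),
      Real.sqrt (2 * k₀ / ρm * (g * (ρp - ρm) - σm * k₀ ^ 2)) = 0 →
      (∀ᶠ k in nhdsWithin k₀ S, 0 < k ∧ σm * k ^ 2 < g * (ρp - ρm)) →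
      Filter.Tendsto lam (nhdsWithin k₀ S) (nhds 0) := by
    intro k₀ S h0 hev
    have ht : Filter.Tendsto
        (fun k : ℝ => Real.sqrt (2 * k / ρm * (g * (ρp - ρm) - σm * k ^ 2)))
        (nhdsWithin k₀ S) (nhds 0) := by
      have := (hcont.tendsto k₀).mono_left (nhdsWithin_le_nhds (s := S))
      rwa [h0] at this
    exact tendsto_of_tendsto_of_tendsto_of_le_of_le' tendsto_const_nhds ht
      (hev.mono fun k hk => (hbd k hk.1 hk.2).1) (hev.mono fun k hk => (hbd k hk.1 hk.2).2)
  constructor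
  · apply key
    · simp
    · have hc : Continuous (fun k : ℝ => σm * k ^ 2) := by fun_prop
      have h1 : ∀ᶠ k in nhds (0 : ℝ), σm * k ^ 2 < g * (ρp - ρm) :=
        (hc.tendsto 0).eventually_lt_const (by simpa using hD)
      filter_upwards [self_mem_nhdsWithin, nhdsWithin_le_nhds h1] with k hk hk2
      exact ⟨hk, hk2⟩
  · intro hσ
    have hq : 0 < g * (ρp - ρm) / σm := div_pos hD hσ
    have hr : 0 < Real.sqrt (g * (ρp - ρm) / σm) := Real.sqrt_pos.2 hq
    have hsq : Real.sqrt (g * (ρp - ρm) / σm) ^ 2 = g * (ρp - ρm) / σm := Real.sq_sqrt hq.le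
    have hm : σm * (g * (ρp - ρm) / σm) = g * (ρp - ρm) := by field_simp
    apply key
    · rw [hsq, hm]
      simp
    · filter_upwards [self_mem_nhdsWithin, nhdsWithin_le_nhds (lt_mem_nhds hr)] with k hk hk2
      refine ⟨hk2, ?_⟩
      have h1 : k ^ 2 < Real.sqrt (g * (ρp - ρm) / σm) ^ 2 :=
        pow_lt_pow_left₀ hk (le_of_lt hk2) (by norm_num)
      calc σm * k ^ 2 < σm * Real.sqrt (g * (ρp - ρm) / σm) ^ 2 :=
            mul_lt_mul_of_pos_left h1 hσ
        _ = g * (ρp - ρm) := by rw [hsq, hm]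
end
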